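/- arXiv:2309.11868 — 2 statements merged into one kernel-verified Lean document; each statement's English description precedes it below -/
import Mathlib

section
/- For finite monotone measures μ, ν on (U, 𝒰), the following are equivalent: (i) there exists a nonnegative measurable function f with μ(A) = ∫_A f dν (Choquet integral) for all A ∈ 𝒰; (ii) there is a decreasing family {A_α}_{α∈ℚ≥0} of measurable sets with A_0 = U such that (μ,ν) has the decomposition property with respect to it and lim_{α→∞} max(μ(A_α), ν(A_α)) = 0. -/
open MeasureTheory Filter Set
open scoped NNReal ENNReal NNRat

variable {U : Type*}

/-- The Choquet integral of `f` w.r.t. the set function `ν` on the set `A`: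
`∫₀^∞ ν({f ≥ t} ∩ A) dt`. -/
noncomputable def Choquet [MeasurableSpace U] (ν : Set U → ENNReal) (f : U → ENNReal)
    (A : Set U) : ENNReal :=
  ∫⁻ t in Set.Ioi (0 : ℝ), ν ({x | ENNReal.ofReal t ≤ f x} ∩ A)

/-- A monotone measure: vanishes at `∅` and is monotone on measurable sets. -/
def IsMonotoneMeasure [MeasurableSpace U] (ν : Set U → ENNReal) : Prop :=
  ν ∅ = 0 ∧ ∀ A B : Set U, MeasurableSet A → MeasurableSet B → A ⊆ B → ν A ≤ ν B

/-- The decomposition inequalities for the ordered pair `(μ, ν)` w.r.t. a family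
`A : NNRat → Set U`, stated additively (no truncated subtraction):
`α(ν(S∩A_α) − ν(S∩A_β)) ≤ μ(S∩A_α) − μ(S∩A_β) ≤ β(ν(S∩A_α) − ν(S∩A_β))`
for all measurable `S` of finite `μ`- and `ν`-measure and rationals `α < β`. -/
def DecompIneq [MeasurableSpace U] (μ ν : Set U → ENNReal) (A : NNRat → Set U) : Prop :=
  ∀ S : Set U, MeasurableSet S → μ S ≠ ⊤ → ν S ≠ ⊤ →
    ∀ α β : NNRat, α < β →
      (((α : ℝ≥0) : ENNReal) * ν (S ∩ A α) + μ (S ∩ A β)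
          ≤ μ (S ∩ A α) + ((α : ℝ≥0) : ENNReal) * ν (S ∩ A β)) ∧
      (μ (S ∩ A α) + ((β : ℝ≥0) : ENNReal) * ν (S ∩ A β)
          ≤ ((β : ℝ≥0) : ENNReal) * ν (S ∩ A α) + μ (S ∩ A β))

/-- The decomposition property: a decreasing family of measurable sets with `A 0 = univ`
satisfying the decomposition inequalities. -/
def DecompProp [MeasurableSpace U] (μ ν : Set U → ENNReal) (A : NNRat → Set U) : Prop :=
  (∀ α, MeasurableSet (A α)) ∧ A 0 = Set.univ ∧ Antitone A ∧ DecompIneq μ ν A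

/-- Comonotonicity for `ℝ≥0∞`-valued functions. -/
def Comonotone (f g : U → ENNReal) : Prop :=
  ∀ s t : U, (f s ≤ f t ∧ g s ≤ g t) ∨ (f t ≤ f s ∧ g t ≤ g s)

theorem rn_core (Φ g : NNRat → ℝ) (h : ℝ → ℝ) (hanti : Antitone h) (hg : ∀ α, 0 ≤ g α)
    (h1 : ∀ α β : NNRat, α < β → ∀ t : ℝ, (α : ℝ) < t → t < (β : ℝ) → g β ≤ h t ∧ h t ≤ g α)
    (h2 : ∀ α β : NNRat, α < β → ((β : ℝ) - α) * g β ≤ Φ α - Φ β ∧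
      Φ α - Φ β ≤ ((β : ℝ) - α) * g α) (N : ℕ) :
    ∫ t in (0 : ℝ)..N, h t = Φ 0 - Φ N := by
  have hint : ∀ a b : ℝ, IntervalIntegrable h volume a b := fun a b =>
    (hanti.antitoneOn _).intervalIntegrable
  have step : ∀ δ : NNRat, 0 < δ → ∀ k : ℕ,
      |(∫ t in (0 : ℝ)..((k * δ : NNRat) : ℝ), h t) - (Φ 0 - Φ (k * δ))|
        ≤ (δ : ℝ) * (g 0 - g (k * δ)) := by
    intro δ hδ k
    induction k with
    | zero => simp
    | succ k ih =>
      have hlt : (k * δ : NNRat) < ((k + 1 : ℕ) : NNRat) * δ := by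
        apply mul_lt_mul_of_pos_right _ hδ
        exact_mod_cast Nat.lt_succ_self k
      have hltR : ((k * δ : NNRat) : ℝ) < ((((k + 1 : ℕ) : NNRat) * δ : NNRat) : ℝ) := by
        exact_mod_cast hlt
      have hd : ((((k + 1 : ℕ) : NNRat) * δ : NNRat) : ℝ) - ((k * δ : NNRat) : ℝ) = (δ : ℝ) := by
        push_cast; ring
      obtain ⟨u1, u2⟩ := h2 _ _ hlt
      have hh := h1 _ _ hlt
      rw [← intervalIntegral.integral_add_adjacent_intervals
        (hint 0 ((k * δ : NNRat) : ℝ)) (hint _ ((((k + 1 : ℕ) : NNRat) * δ : NNRat) : ℝ))]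
      rw [hd] at u1 u2
      generalize ((k + 1 : ℕ) : NNRat) * δ = b at *
      generalize (k : NNRat) * δ = a at *
      have l1 : (δ : ℝ) * g b ≤ ∫ t in (a : ℝ)..b, h t := by
        have := intervalIntegral.integral_mono_on_of_le_Ioo (μ := volume) hltR.le
          (f := fun _ => g b) (g := h) (by simp) (hint _ _)
          (fun x hx => (hh x hx.1 hx.2).1)
        simpa [hd] using this
      have l2 : (∫ t in (a : ℝ)..b, h t) ≤ (δ : ℝ) * g a := by
        have := intervalIntegral.integral_mono_on_of_le_Ioo (μ := volume) hltR.le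
          (f := h) (g := fun _ => g a) (hint _ _) (by simp)
          (fun x hx => (hh x hx.1 hx.2).2)
        simpa [hd] using this
      rw [abs_le] at ih ⊢
      constructor <;> linarith [ih.1, ih.2]
  have bound : ∀ n : ℕ, |(∫ t in (0 : ℝ)..N, h t) - (Φ 0 - Φ N)| ≤ g 0 * (1 / ((n : ℝ) + 1)) := by
    intro n
    have := step (1 / ((n : NNRat) + 1)) (by positivity) (N * (n + 1))
    have e : (((N * (n + 1) : ℕ) : NNRat) * (1 / ((n : NNRat) + 1))) = N := by
      push_cast
      field_simp
    rw [e] at this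
    have e2 : ((1 / ((n : NNRat) + 1) : NNRat) : ℝ) = 1 / ((n : ℝ) + 1) := by push_cast; rfl
    rw [e2] at this
    have e3 : (((N : NNRat)) : ℝ) = (N : ℝ) := by push_cast; rfl
    rw [e3] at this
    refine this.trans ?_
    have p : 0 < 1 / ((n : ℝ) + 1) := by positivity
    nlinarith [hg N]
  have lim : Tendsto (fun n : ℕ => g 0 * (1 / ((n : ℝ) + 1))) atTop (nhds 0) := by
    simpa using (tendsto_one_div_add_atTop_nhds_zero_nat (𝕜 := ℝ)).const_mul (g 0)
  have := ge_of_tendsto' lim bound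
  have := abs_nonpos_iff.1 this
  linarith

theorem rn_cast (α : NNRat) : ((α : ℝ≥0) : ENNReal) = ENNReal.ofReal (α : ℝ) := by
  have : (α : ℝ) = ((α : ℝ≥0) : ℝ) := rfl
  rw [this, ENNReal.ofReal_coe_nnreal]

theorem rn_lint (h : ℝ → ℝ) (hanti : Antitone h) (h0 : ∀ t, 0 ≤ h t) (c : ℝ)
    (hl : Tendsto (fun N : ℕ => ∫ t in (0 : ℝ)..N, h t) atTop (nhds c)) :
    ∫⁻ t in Ioi (0 : ℝ), ENNReal.ofReal (h t) = ENNReal.ofReal c := by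
  have hint : ∀ a b : ℝ, IntervalIntegrable h volume a b := fun a b =>
    (hanti.antitoneOn _).intervalIntegrable
  have hI : IntegrableOn h (Ioi 0) := by
    refine integrableOn_Ioi_of_intervalIntegral_norm_tendsto c 0
      (fun N : ℕ => ((hint 0 N).1)) tendsto_natCast_atTop_atTop ?_
    simpa only [Real.norm_of_nonneg (h0 _)] using hl
  rw [← ofReal_integral_eq_lintegral_ofReal hI (ae_of_all _ h0)]
  congr 1
  exact tendsto_nhds_unique
    (intervalIntegral_tendsto_integral_Ioi 0 hI tendsto_natCast_atTop_atTop) hl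

theorem rn_back [MeasurableSpace U] (μ ν : Set U → ENNReal)
    (hμ : IsMonotoneMeasure μ) (hν : IsMonotoneMeasure ν)
    (hμfin : μ Set.univ ≠ ⊤) (hνfin : ν Set.univ ≠ ⊤) (A : NNRat → Set U)
    (hA : DecompProp μ ν A)
    (hlim : Tendsto (fun α : NNRat => max (μ (A α)) (ν (A α))) atTop (nhds 0)) :
    ∃ f : U → ENNReal, Measurable f ∧
        ∀ S : Set U, MeasurableSet S → μ S = Choquet ν f S := by
  obtain ⟨hm, hA0, hAa, hD⟩ := hA
  set f : U → ENNReal := fun x => ⨆ α : NNRat, (A α).indicator (fun _ => ENNReal.ofReal (α : ℝ)) x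
    with hf
  have hfm : Measurable f := Measurable.iSup fun α => measurable_const.indicator (hm α)
  have hlev : ∀ t : ℝ, MeasurableSet {x | ENNReal.ofReal t ≤ f x} := fun t =>
    measurableSet_le measurable_const hfm
  refine ⟨f, hfm, fun S hS => ?_⟩
  have fμ : ∀ T : Set U, MeasurableSet T → μ T ≠ ⊤ := fun T hT =>
    ((hμ.2 T univ hT .univ (subset_univ _)).trans_lt hμfin.lt_top).ne
  have fν : ∀ T : Set U, MeasurableSet T → ν T ≠ ⊤ := fun T hT =>
    ((hν.2 T univ hT .univ (subset_univ _)).trans_lt hνfin.lt_top).ne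
  have mS : ∀ α, MeasurableSet (S ∩ A α) := fun α => hS.inter (hm α)
  let G : NNRat → ℝ := fun α => (μ (S ∩ A α)).toReal
  let g : NNRat → ℝ := fun α => (ν (S ∩ A α)).toReal
  let h : ℝ → ℝ := fun t => (ν ({x | ENNReal.ofReal t ≤ f x} ∩ S)).toReal
  have hG0 : ∀ α, 0 ≤ G α := fun _ => ENNReal.toReal_nonneg
  have hg0 : ∀ α, 0 ≤ g α := fun _ => ENNReal.toReal_nonneg
  have hc0 : ∀ α : NNRat, (0 : ℝ) ≤ α := fun α => by positivity
  have hanti : Antitone h := by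
    intro s t hst
    refine ENNReal.toReal_mono (fν _ ((hlev _).inter hS))
      (hν.2 _ _ ((hlev _).inter hS) ((hlev _).inter hS) (inter_subset_inter_left _ ?_))
    intro x hx
    exact (ENNReal.ofReal_le_ofReal hst).trans hx
  have hDR : ∀ α β : NNRat, α < β → (α : ℝ) * g α + G β ≤ G α + α * g β ∧
      G α + β * g β ≤ β * g α + G β := by
    intro α β hαβ
    obtain ⟨d1, d2⟩ := hD S hS (fμ S hS) (fν S hS) α β hαβ
    have e : ∀ γ δ ε : NNRat, ((γ : ℝ≥0) : ENNReal) * ν (S ∩ A δ) + μ (S ∩ A ε)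
        = ENNReal.ofReal ((γ : ℝ) * g δ + G ε) := by
      intro γ δ ε
      rw [rn_cast, ENNReal.ofReal_add (mul_nonneg (hc0 _) (hg0 _)) (hG0 _),
        ENNReal.ofReal_mul (hc0 _), ENNReal.ofReal_toReal (fν _ (mS _)),
        ENNReal.ofReal_toReal (fμ _ (mS _))]
    have pos : ∀ γ δ ε : NNRat, 0 ≤ (γ : ℝ) * g δ + G ε := fun γ δ ε =>
      add_nonneg (mul_nonneg (hc0 _) (hg0 _)) (hG0 _)
    rw [add_comm (μ (S ∩ A α)), e, e, ENNReal.ofReal_le_ofReal_iff (pos _ _ _)] at d1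
    rw [add_comm (μ (S ∩ A α)), e, e, ENNReal.ofReal_le_ofReal_iff (pos _ _ _)] at d2
    constructor <;> linarith
  have key := rn_core (fun α => G α - α * g α) g h hanti hg0
    (by
      intro α β hαβ t h1 h2
      have mm := (hlev t).inter hS
      constructor
      · refine ENNReal.toReal_mono (fν _ mm) (hν.2 _ _ (mS _) mm ?_)
        rintro x ⟨xS, xA⟩
        refine ⟨?_, xS⟩
        refine (ENNReal.ofReal_le_ofReal h2.le).trans (le_trans (le_of_eq ?_)
          (le_iSup (fun α : NNRat => (A α).indicator (fun _ => ENNReal.ofReal (α : ℝ)) x) β))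
        simp [indicator_of_mem xA]
      · refine ENNReal.toReal_mono (fν _ (mS _)) (hν.2 _ _ mm (mS _) ?_)
        rintro x ⟨xt, xS⟩
        refine ⟨xS, ?_⟩
        have : ENNReal.ofReal (α : ℝ) < f x :=
          lt_of_lt_of_le ((ENNReal.ofReal_lt_ofReal_iff (lt_of_le_of_lt (hc0 α) h1)).2 h1) xt
        obtain ⟨γ, hγ⟩ := lt_iSup_iff.1 this
        by_cases xγ : x ∈ A γ
        · rw [indicator_of_mem xγ] at hγ
          have := (ENNReal.ofReal_lt_ofReal_iff_of_nonneg (hc0 α)).1 hγ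
          exact hAa (by exact_mod_cast this.le) xγ
        · rw [indicator_of_notMem xγ] at hγ
          simp at hγ)
    (by
      intro α β hαβ
      obtain ⟨d1, d2⟩ := hDR α β hαβ
      constructor <;> linarith)
  have castlim : Tendsto (fun n : ℕ => (n : NNRat)) atTop atTop := tendsto_natCast_atTop_atTop
  have hlimN := hlim.comp castlim
  have hGlim : Tendsto (fun n : ℕ => G n) atTop (nhds 0) := by
    have : Tendsto (fun n : ℕ => μ (S ∩ A n)) atTop (nhds 0) :=
      tendsto_of_tendsto_of_tendsto_of_le_of_le tendsto_const_nhds hlimN (fun _ => zero_le)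
        (fun n => (hμ.2 _ _ (mS _) (hm _) inter_subset_right).trans (le_max_left _ _))
    exact (ENNReal.tendsto_toReal ENNReal.zero_ne_top).comp this
  have hglim : Tendsto (fun n : ℕ => g n) atTop (nhds 0) := by
    have : Tendsto (fun n : ℕ => ν (S ∩ A n)) atTop (nhds 0) :=
      tendsto_of_tendsto_of_tendsto_of_le_of_le tendsto_const_nhds hlimN (fun _ => zero_le)
        (fun n => (hν.2 _ _ (mS _) (hm _) inter_subset_right).trans (le_max_right _ _))
    exact (ENNReal.tendsto_toReal ENNReal.zero_ne_top).comp this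
  have hle : ∀ α : NNRat, (α : ℝ) * g α ≤ G α := by
    intro α
    have : Tendsto (fun n : ℕ => G α + α * g n) atTop (nhds (G α)) := by
      simpa using (hglim.const_mul (α : ℝ)).const_add (G α)
    refine ge_of_tendsto this ?_
    filter_upwards [castlim.eventually_gt_atTop α] with n hn
    have := (hDR α n hn).1
    have := hG0 n
    linarith
  have hglim2 : Tendsto (fun n : ℕ => ((n : NNRat) : ℝ) * g n) atTop (nhds 0) :=
    tendsto_of_tendsto_of_tendsto_of_le_of_le tendsto_const_nhds hGlim
      (fun n => mul_nonneg (hc0 _) (hg0 _)) (fun n => hle n)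
  have fin := rn_lint h hanti (fun _ => ENNReal.toReal_nonneg) (G 0) (by
    simp only [key]
    simpa using (hGlim.sub hglim2).const_sub (G 0))
  have e1 : ∀ t, ENNReal.ofReal (h t) = ν ({x | ENNReal.ofReal t ≤ f x} ∩ S) := fun t =>
    ENNReal.ofReal_toReal (fν _ ((hlev _).inter hS))
  simp only [e1] at fin
  rw [Choquet, fin, ENNReal.ofReal_toReal (fμ _ (mS _)), hA0, inter_univ]

theorem rn_split (h : ℝ → ENNReal) (a b : ℝ) (hab : a ≤ b) :
    ∫⁻ t in Ioi a, h t = (∫⁻ t in Ioc a b, h t) + ∫⁻ t in Ioi b, h t := by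
  rw [← Ioc_union_Ioi_eq_Ioi hab, lintegral_union measurableSet_Ioi]
  exact Set.Ioc_disjoint_Ioi le_rfl

theorem rn_low (h : ℝ → ENNReal) (hh : Antitone h) (a b : ℝ) :
    ENNReal.ofReal (b - a) * h b ≤ ∫⁻ t in Ioc a b, h t := by
  calc _ = ∫⁻ t in Ioc a b, h b := by simp [mul_comm]
    _ ≤ _ := setLIntegral_mono' measurableSet_Ioc fun t ht => hh ht.2

theorem rn_high (h : ℝ → ENNReal) (hh : Antitone h) (a b : ℝ) :
    ∫⁻ t in Ioc a b, h t ≤ ENNReal.ofReal (b - a) * h a := by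
  calc _ ≤ ∫⁻ t in Ioc a b, h a := setLIntegral_mono' measurableSet_Ioc fun t ht => hh ht.1.le
    _ = _ := by simp [mul_comm]

theorem rn_tail (h : ℝ → ENNReal) (hfin : ∫⁻ t in Ioi (0 : ℝ), h t ≠ ⊤) :
    Tendsto (fun a : ℝ => ∫⁻ t in Ioi a, h t) atTop (nhds 0) := by
  have key := tendsto_measure_iInter_atTop (μ := volume.withDensity h) (s := fun a : ℝ => Ioi a)
    (fun i => measurableSet_Ioi.nullMeasurableSet) (fun a b hab => Ioi_subset_Ioi hab)
    ⟨0, by rw [withDensity_apply _ measurableSet_Ioi]; exact hfin⟩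
  have : (⋂ a : ℝ, Ioi a) = ∅ := by
    ext x
    simp only [mem_iInter, mem_Ioi, mem_empty_iff_false, iff_false, not_forall, not_lt]
    exact ⟨x, le_rfl⟩
  rw [this, measure_empty] at key
  simpa only [Function.comp_def, withDensity_apply _ measurableSet_Ioi] using key

theorem rn_forw [MeasurableSpace U] (μ ν : Set U → ENNReal)
    (hν : IsMonotoneMeasure ν)
    (hμfin : μ Set.univ ≠ ⊤) (f : U → ENNReal) (hfm : Measurable f)
    (hf : ∀ A : Set U, MeasurableSet A → μ A = Choquet ν f A) :
    ∃ A : NNRat → Set U, DecompProp μ ν A ∧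
        Tendsto (fun α : NNRat => max (μ (A α)) (ν (A α))) atTop (nhds 0) := by
  have hlev : ∀ t : ℝ, MeasurableSet {x | ENNReal.ofReal t ≤ f x} := fun t =>
    measurableSet_le measurable_const hfm
  let h : Set U → ℝ → ENNReal := fun S t => ν ({x | ENNReal.ofReal t ≤ f x} ∩ S)
  have hanti : ∀ S, MeasurableSet S → Antitone (h S) := by
    intro S hS s t hst
    refine hν.2 _ _ ((hlev _).inter hS) ((hlev _).inter hS) (inter_subset_inter_left _ ?_)
    intro x hx
    exact (ENNReal.ofReal_le_ofReal hst).trans hx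
  let A : NNRat → Set U := fun α => {x | ENNReal.ofReal (α : ℝ) ≤ f x}
  have hνA : ∀ (S : Set U) (α : NNRat), ν (S ∩ A α) = h S α := fun S α => by rw [inter_comm]
  have hμA : ∀ S, MeasurableSet S → ∀ α : NNRat,
      μ (S ∩ A α) = ENNReal.ofReal (α : ℝ) * h S α + ∫⁻ t in Ioi (α : ℝ), h S t := by
    intro S hS α
    rw [hf _ (hS.inter (hlev _)), Choquet, rn_split _ 0 (α : ℝ) (by positivity)]
    congr 1
    · calc _ = ∫⁻ t in Ioc (0 : ℝ) α, h S α := by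
            refine setLIntegral_congr_fun measurableSet_Ioc fun t ht => ?_
            show ν _ = ν _
            congr 1
            ext x
            constructor
            · rintro ⟨_, x2, x3⟩
              exact ⟨x3, x2⟩
            · rintro ⟨x3, x2⟩
              exact ⟨(ENNReal.ofReal_le_ofReal ht.2).trans x3, x2, x3⟩
        _ = _ := by simp [mul_comm]
    · refine setLIntegral_congr_fun measurableSet_Ioi fun t ht => ?_
      show ν _ = ν _
      congr 1
      ext x
      constructor
      · rintro ⟨x1, x2, x3⟩
        exact ⟨x1, x2⟩
      · rintro ⟨x1, x2⟩
        exact ⟨x1, x2, (ENNReal.ofReal_le_ofReal (le_of_lt ht)).trans x1⟩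
  refine ⟨A, ⟨fun α => hlev _, ?_, ?_, ?_⟩, ?_⟩
  · ext x; simp [A]
  · intro α β hαβ x hx
    exact (ENNReal.ofReal_le_ofReal (by exact_mod_cast hαβ)).trans hx
  · intro S hS _ _ α β hαβ
    have hR : (α : ℝ) < β := by exact_mod_cast hαβ
    have e : ENNReal.ofReal (β : ℝ) = ENNReal.ofReal (α : ℝ) + ENNReal.ofReal ((β : ℝ) - α) := by
      rw [← ENNReal.ofReal_add (by positivity) (by linarith)]; congr 1; ring
    have l := rn_low (h S) (hanti S hS) α β
    have u := rn_high (h S) (hanti S hS) α β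
    rw [hμA S hS, hμA S hS, hνA, hνA, rn_cast, rn_cast, rn_split (h S) α β hR.le, e]
    generalize ENNReal.ofReal ((β : ℝ) - α) = d at *
    generalize ENNReal.ofReal (α : ℝ) = a at *
    generalize (∫⁻ t in Ioc (α : ℝ) β, h S t) = I at *
    generalize (∫⁻ t in Ioi (β : ℝ), h S t) = J at *
    generalize h S α = x at *
    generalize h S β = y at *
    constructor
    · calc a * x + ((a + d) * y + J) = a * x + a * y + J + d * y := by ring
        _ ≤ a * x + a * y + J + I := by gcongr
        _ = _ := by ring
    · calc a * x + (I + J) + (a + d) * y = a * x + J + (a + d) * y + I := by ring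
        _ ≤ a * x + J + (a + d) * y + d * x := by gcongr
        _ = _ := by ring
  · have hfin : ∫⁻ t in Ioi (0 : ℝ), h univ t ≠ ⊤ := by
      have := hf univ .univ
      rw [Choquet] at this
      exact this ▸ hμfin
    have T := rn_tail _ hfin
    have castlim : Tendsto (fun α : NNRat => (α : ℝ) / 2) atTop atTop := by
      rw [tendsto_atTop]
      intro b
      obtain ⟨n, hn⟩ := exists_nat_ge (2 * b)
      filter_upwards [eventually_ge_atTop (n : NNRat)] with α hα
      have : (n : ℝ) ≤ α := by exact_mod_cast hα
      linarith
    have T3 := ENNReal.Tendsto.const_mul (a := 3) (T.comp castlim) (Or.inr (by simp))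
    rw [mul_zero] at T3
    refine tendsto_of_tendsto_of_tendsto_of_le_of_le' tendsto_const_nhds T3
      (Eventually.of_forall fun _ => zero_le) ?_
    filter_upwards [eventually_ge_atTop (1 : NNRat)] with α hα
    have hα1 : (1 : ℝ) ≤ α := by exact_mod_cast hα
    have hm := hμA univ .univ α
    have hn := hνA univ α
    rw [univ_inter] at hm hn
    have b1 : ν (A α) ≤ μ (A α) := by
      rw [hm, hn]
      refine le_trans ?_ le_self_add
      calc h univ α = 1 * h univ α := (one_mul _).symm
        _ ≤ _ := by
          gcongr
          exact ENNReal.one_le_ofReal.2 hα1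
    rw [max_eq_left b1, hm]
    have l := rn_low (h univ) (hanti _ .univ) ((α : ℝ) / 2) α
    have s := rn_split (h univ) ((α : ℝ) / 2) α (by linarith)
    have e : ENNReal.ofReal (α : ℝ) = 2 * ENNReal.ofReal ((α : ℝ) - α / 2) := by
      rw [← ENNReal.ofReal_ofNat 2, ← ENNReal.ofReal_mul (by norm_num)]; congr 1; ring
    rw [e]
    simp only [Function.comp]
    rw [s]
    generalize ENNReal.ofReal ((α : ℝ) - α / 2) = d at *
    generalize (∫⁻ t in Ioc ((α : ℝ) / 2) α, h univ t) = I at *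
    generalize (∫⁻ t in Ioi (α : ℝ), h univ t) = J at *
    calc 2 * d * h univ α + J = 2 * (d * h univ α) + J := by ring
      _ ≤ 2 * I + J := by gcongr
      _ ≤ 2 * I + J + (I + 2 * J) := le_self_add
      _ = 3 * (I + J) := by ring

theorem radon_nikodym_finite [MeasurableSpace U] (μ ν : Set U → ENNReal)
    (hμ : IsMonotoneMeasure μ) (hν : IsMonotoneMeasure ν)
    (hμfin : μ Set.univ ≠ ⊤) (hνfin : ν Set.univ ≠ ⊤) :
    (∃ f : U → ENNReal, Measurable f ∧
        ∀ A : Set U, MeasurableSet A → μ A = Choquet ν f A) ↔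
    (∃ A : NNRat → Set U, DecompProp μ ν A ∧
        Tendsto (fun α : NNRat => max (μ (A α)) (ν (A α))) atTop (nhds 0)) := by
  constructor
  · rintro ⟨f, hfm, hf⟩
    exact rn_forw μ ν hν hμfin f hfm hf
  · rintro ⟨A, hA, hlim⟩
    exact rn_back μ ν hμ hν hμfin hνfin A hA hlim
end

section
/- For a null-additive monotone measure ν and nonnegative measurable functions f, g with f = g ν-almost everywhere (i.e., ν({f ≠ g}) = 0), the Choquet integrals of f and g coincide: ∫ f dν = ∫ g dν. -/
open MeasureTheory Filter Set
open scoped NNReal ENNReal NNRat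

variable {U : Type*}

theorem choquet_congr_ae [MeasurableSpace U] (ν : Set U → ENNReal)
    (hν : IsMonotoneMeasure ν)
    (hna : ∀ A N : Set U, MeasurableSet A → MeasurableSet N →
      ν N = 0 → ν (A ∪ N) = ν A)
    (f g : U → ENNReal) (hf : Measurable f) (hg : Measurable g)
    (hae : ν {x | f x ≠ g x} = 0) :
    Choquet ν f Set.univ = Choquet ν g Set.univ := by
  have hN : MeasurableSet {x | f x ≠ g x} := (measurableSet_eq_fun hf hg).compl
  unfold Choquet
  congr 1
  funext t
  simp only [Set.inter_univ]
  have hA : MeasurableSet {x | ENNReal.ofReal t ≤ f x} := measurableSet_le measurable_const hf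
  have hB : MeasurableSet {x | ENNReal.ofReal t ≤ g x} := measurableSet_le measurable_const hg
  rw [← hna _ _ hA hN hae, ← hna _ _ hB hN hae]
  congr 1
  ext x
  simp only [Set.mem_union, Set.mem_setOf_eq]
  by_cases h : f x = g x
  · rw [h]
  · simp [h]
end
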